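/- Let n ≥ 2 and let J₁ : ℝ^{2n−2} × ℝ² → M_{2n−2}(ℝ) be a C¹ map with J₁(u,v)ᵀJ₁(u,v) = I and J₁(u,v)² = −I for all (u,v), such that for each fixed v ∈ ℝ² the map u ↦ J₁(u,v) has vanishing Nijenhuis tensor on ℝ^{2n−2}. Define J : ℝ^{2n} = ℝ^{2n−2} × ℝ² → M_{2n}(ℝ) by J(u,v) = blockdiag(J₁(u,v), J₀), where J₀ = [[0,−1],[1,0]]. Then the Nijenhuis tensor of J vanishes identically on ℝ^{2n} if and only if, writing v = (x,y), the identity (∂J₁/∂y)(u,v) = J₁(u,v)·(∂J₁/∂x)(u,v) holds for all (u,v) — that is, if and only if for each fixed u the map v ↦ J₁(u,v) is holomorphic from (ℝ², J₀) into the space of complex structures, whose complex structure at J₁ sends a tangent matrix A (anticommuting with J₁) to J₁·A. -/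

import Mathlib

open Matrix Filter

attribute [local instance] Matrix.normedAddCommGroup Matrix.normedSpace

/-- The Nijenhuis tensor of a matrix-valued map `J`. -/
noncomputable def nijenhuis {ι : Type*} [Fintype ι]
    (J : (ι → ℝ) → Matrix ι ι ℝ) (x v w : ι → ℝ) : ι → ℝ :=
  (fderiv ℝ J x ((J x).mulVec v)).mulVec w
    - (fderiv ℝ J x ((J x).mulVec w)).mulVec v
    + (J x).mulVec ((fderiv ℝ J x w).mulVec v)
    - (J x).mulVec ((fderiv ℝ J x v).mulVec w)

section BlockDiagonal

variable {ι κ : Type*} [Fintype ι] [Fintype κ]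

theorem fderiv_uncurry_apply {E F G : Type*} [NormedAddCommGroup E] [NormedSpace ℝ E]
    [NormedAddCommGroup F] [NormedSpace ℝ F] [NormedAddCommGroup G] [NormedSpace ℝ G]
    {f : E → F → G} {u : E} {v : F}
    (hf : DifferentiableAt ℝ (fun p : E × F => f p.1 p.2) (u, v)) (a : E) (b : F) :
    fderiv ℝ (fun p : E × F => f p.1 p.2) (u, v) (a, b)
      = fderiv ℝ (fun u' => f u' v) u a + fderiv ℝ (fun v' => f u v') v b := by
  have h₁ : HasFDerivAt (fun u' => f u' v) _ u :=
    HasFDerivAt.comp (f := fun u' => (u', v)) u hf.hasFDerivAt (hasFDerivAt_prodMk_left u v)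
  have h₂ : HasFDerivAt (fun v' => f u v') _ v :=
    HasFDerivAt.comp (f := fun v' => (u, v')) v hf.hasFDerivAt (hasFDerivAt_prodMk_right u v)
  rw [h₁.fderiv, h₂.fderiv]
  simp [← map_add]

theorem hasFDerivAt_fromBlocks_diagonal {J : (ι → ℝ) → (κ → ℝ) → Matrix ι ι ℝ}
    (C : Matrix κ κ ℝ) (x : ι ⊕ κ → ℝ)
    (hJ : DifferentiableAt ℝ (fun p : (ι → ℝ) × (κ → ℝ) => J p.1 p.2)
      (x ∘ Sum.inl, x ∘ Sum.inr)) :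
    ∃ L : (ι ⊕ κ → ℝ) →L[ℝ] Matrix (ι ⊕ κ) (ι ⊕ κ) ℝ,
      HasFDerivAt (fun x : ι ⊕ κ → ℝ =>
        Matrix.fromBlocks (J (x ∘ Sum.inl) (x ∘ Sum.inr)) 0 0 C) L x ∧
      ∀ h, L h = Matrix.fromBlocks
        (fderiv ℝ (fun u => J u (x ∘ Sum.inr)) (x ∘ Sum.inl) (h ∘ Sum.inl)
          + fderiv ℝ (J (x ∘ Sum.inl)) (x ∘ Sum.inr) (h ∘ Sum.inr)) 0 0 0 := by
  let S : (ι ⊕ κ → ℝ) →L[ℝ] (ι → ℝ) × (κ → ℝ) := LinearMap.toContinuousLinearMap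
    { toFun := fun x => (x ∘ Sum.inl, x ∘ Sum.inr)
      map_add' := fun _ _ => rfl
      map_smul' := fun _ _ => rfl }
  let B : Matrix ι ι ℝ →L[ℝ] Matrix (ι ⊕ κ) (ι ⊕ κ) ℝ := LinearMap.toContinuousLinearMap
    { toFun := fun A => Matrix.fromBlocks A 0 0 0
      map_add' := fun _ _ => by simp [Matrix.fromBlocks_add]
      map_smul' := fun _ _ => by simp [Matrix.fromBlocks_smul] }
  refine ⟨B.comp ((fderiv ℝ (fun p : (ι → ℝ) × (κ → ℝ) => J p.1 p.2)
    (x ∘ Sum.inl, x ∘ Sum.inr)).comp S), ?_,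
    fun h => congrArg (Matrix.fromBlocks · 0 0 0) (fderiv_uncurry_apply hJ _ _)⟩
  have hS : HasFDerivAt (fun x => J (S x).1 (S x).2) _ x :=
    HasFDerivAt.comp (g := fun p : (ι → ℝ) × (κ → ℝ) => J p.1 p.2) x
      (show HasFDerivAt _ _ (S x) from hJ.hasFDerivAt) S.hasFDerivAt
  have hB := (B.hasFDerivAt.comp x hS).add_const (Matrix.fromBlocks 0 0 0 C)
  refine hB.congr_of_eventuallyEq (Filter.Eventually.of_forall fun y => ?_)
  change _ = Matrix.fromBlocks (J (y ∘ Sum.inl) (y ∘ Sum.inr)) 0 0 0 + _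
  simp [Matrix.fromBlocks_add]

theorem nijenhuis_fromBlocks_diagonal {J : (ι → ℝ) → (κ → ℝ) → Matrix ι ι ℝ}
    (C : Matrix κ κ ℝ) (x v w : ι ⊕ κ → ℝ)
    (hJ : DifferentiableAt ℝ (fun p : (ι → ℝ) × (κ → ℝ) => J p.1 p.2)
      (x ∘ Sum.inl, x ∘ Sum.inr)) :
    nijenhuis (fun x : ι ⊕ κ → ℝ =>
        Matrix.fromBlocks (J (x ∘ Sum.inl) (x ∘ Sum.inr)) 0 0 C) x v w
      = Sum.elim
        (nijenhuis (fun u => J u (x ∘ Sum.inr)) (x ∘ Sum.inl) (v ∘ Sum.inl) (w ∘ Sum.inl)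
          + (fderiv ℝ (J (x ∘ Sum.inl)) (x ∘ Sum.inr) (C *ᵥ (v ∘ Sum.inr))
              - J (x ∘ Sum.inl) (x ∘ Sum.inr)
                * fderiv ℝ (J (x ∘ Sum.inl)) (x ∘ Sum.inr) (v ∘ Sum.inr)) *ᵥ (w ∘ Sum.inl)
          - (fderiv ℝ (J (x ∘ Sum.inl)) (x ∘ Sum.inr) (C *ᵥ (w ∘ Sum.inr))
              - J (x ∘ Sum.inl) (x ∘ Sum.inr)
                * fderiv ℝ (J (x ∘ Sum.inl)) (x ∘ Sum.inr) (w ∘ Sum.inr)) *ᵥ (v ∘ Sum.inl))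
        0 := by
  obtain ⟨L, hL, hL'⟩ := hasFDerivAt_fromBlocks_diagonal C x hJ
  simp only [nijenhuis, hL.fderiv, hL', Matrix.fromBlocks_mulVec,
    Sum.elim_comp_inl, Sum.elim_comp_inr, Matrix.zero_mulVec, add_zero, zero_add,
    Matrix.add_mulVec, Matrix.sub_mulVec, Matrix.mulVec_add, ← Matrix.mulVec_mulVec]
  ext (i | i)
  · simp only [Pi.add_apply, Pi.sub_apply, Sum.elim_inl]
    ring
  · simp

end BlockDiagonal

/-- **Integrability of warped product almost complex structures.**
Let `J₁(u,v)` be a `C¹` family of orthogonal almost complex structures on `ℝ^{2n−2}`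
(parametrized by `(u,v) ∈ ℝ^{2n−2} × ℝ²`) that is integrable in `u` for each fixed `v`.
Then the block diagonal warped product `J = J₁ ⊕ J₀` on `ℝ^{2n} = ℝ^{2n−2} × ℝ²` has
vanishing Nijenhuis tensor if and only if `∂J₁/∂y = J₁·(∂J₁/∂x)` everywhere, i.e.
`v ↦ J₁(u,v)` is holomorphic from `(ℝ², J₀)` into the space of complex structures. -/
theorem warped_product_integrability (n : ℕ) (hn : 2 ≤ n)
    (J₁ : (Fin (2 * n - 2) → ℝ) → (Fin 2 → ℝ) → Matrix (Fin (2 * n - 2)) (Fin (2 * n - 2)) ℝ)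
    (hC1 : ContDiff ℝ 1 (fun p : (Fin (2 * n - 2) → ℝ) × (Fin 2 → ℝ) => J₁ p.1 p.2))
    (horth : ∀ u v, (J₁ u v)ᵀ * J₁ u v = 1)
    (hsq : ∀ u v, J₁ u v * J₁ u v = -1)
    (hint : ∀ (v : Fin 2 → ℝ) (u x y : Fin (2 * n - 2) → ℝ),
      nijenhuis (fun u' => J₁ u' v) u x y = 0) :
    (∀ x v w : (Fin (2 * n - 2) ⊕ Fin 2) → ℝ,
        nijenhuis (fun x : (Fin (2 * n - 2) ⊕ Fin 2) → ℝ =>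
          Matrix.fromBlocks (J₁ (x ∘ Sum.inl) (x ∘ Sum.inr)) 0 0 !![0, -1; 1, 0]) x v w = 0)
      ↔ (∀ (u : Fin (2 * n - 2) → ℝ) (v : Fin 2 → ℝ),
          fderiv ℝ (fun w => J₁ u w) v (Pi.single 1 1)
            = J₁ u v * fderiv ℝ (fun w => J₁ u w) v (Pi.single 0 1)) := by
  have hd : ∀ p, DifferentiableAt ℝ (fun p : (Fin (2 * n - 2) → ℝ) × (Fin 2 → ℝ) =>
    J₁ p.1 p.2) p := fun p => hC1.differentiable one_ne_zero p
  simp only [nijenhuis_fromBlocks_diagonal _ _ _ _ (hd _), hint, zero_add]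
  constructor
  · intro h u v
    rw [← sub_eq_zero]
    refine Matrix.ext_of_mulVec_single fun i => ?_
    have hi := h (Sum.elim u v) (Sum.elim 0 (Pi.single 0 1)) (Sum.elim (Pi.single i 1) 0)
    have hrot : !![0, -1; 1, 0] *ᵥ (Pi.single 0 1 : Fin 2 → ℝ) = Pi.single 1 1 := by
      ext j; fin_cases j <;> simp
    simp only [Sum.elim_comp_inl, Sum.elim_comp_inr, hrot, Matrix.mulVec_zero, sub_zero] at hi
    ext j
    simpa using congrFun hi (Sum.inl j)
  · intro h x v w
    have hx : fderiv ℝ (J₁ (x ∘ Sum.inl)) (x ∘ Sum.inr) (Pi.single 1 1)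
        = J₁ (x ∘ Sum.inl) (x ∘ Sum.inr)
          * fderiv ℝ (J₁ (x ∘ Sum.inl)) (x ∘ Sum.inr) (Pi.single 0 1) := h _ _
    have key : ∀ b : Fin 2 → ℝ,
        fderiv ℝ (J₁ (x ∘ Sum.inl)) (x ∘ Sum.inr) (!![0, -1; 1, 0] *ᵥ b)
          - J₁ (x ∘ Sum.inl) (x ∘ Sum.inr)
            * fderiv ℝ (J₁ (x ∘ Sum.inl)) (x ∘ Sum.inr) b = 0 := by
      intro b
      have hb : b = b 0 • Pi.single 0 1 + b 1 • Pi.single 1 1 := by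
        ext j; fin_cases j <;> simp
      have hrot : !![0, -1; 1, 0] *ᵥ b = -b 1 • Pi.single 0 1 + b 0 • Pi.single 1 1 := by
        ext j; fin_cases j <;> simp [Matrix.mulVec, dotProduct]
      rw [hrot]
      conv_lhs => enter [2]; rw [hb]
      simp only [map_add, map_smul, hx, Matrix.mul_add, Matrix.mul_smul, ← Matrix.mul_assoc, hsq]
      simp [add_comm]
    rw [key, key]
    ext (i | i) <;> simp
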